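/- The left reduction 𝒟 of a Dyck automaton 𝒜 presents the same sofic-Dyck shift as 𝒜; more precisely, a finite word over A is the label of a finite admissible path of 𝒜 if and only if it is the label of a finite admissible path of 𝒟. -/

import Mathlib

namespace SD

/-- The three kinds of letters of a pushdown alphabet. -/
inductive LetterKind : Type
  | call
  | ret
  | intern
  deriving DecidableEq

/-- A pushdown alphabet structure on `A`: a partition of the letters into
call letters, return letters and internal letters. -/
structure PushdownAlphabet (A : Type*) where
  kind : A → LetterKind

/-- Number of call letters of a word. -/
def callCount {A : Type*} (P : PushdownAlphabet A) (u : List A) : ℕ :=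
  u.countP (fun a => decide (P.kind a = LetterKind.call))

/-- Number of return letters of a word. -/
def retCount {A : Type*} (P : PushdownAlphabet A) (u : List A) : ℕ :=
  u.countP (fun a => decide (P.kind a = LetterKind.ret))

/-- A word is matched-return if every prefix has at least as many call letters
as return letters. -/
def MatchedReturn {A : Type*} (P : PushdownAlphabet A) (u : List A) : Prop :=
  ∀ v w : List A, u = v ++ w → retCount P v ≤ callCount P v

/-- A word is matched-call if every suffix has at least as many return letters
as call letters. -/
def MatchedCall {A : Type*} (P : PushdownAlphabet A) (u : List A) : Prop :=
  ∀ v w : List A, u = v ++ w → callCount P w ≤ retCount P w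

/-- A Dyck word is a word which is both matched-return and matched-call. -/
def IsDyck {A : Type*} (P : PushdownAlphabet A) (u : List A) : Prop :=
  MatchedReturn P u ∧ MatchedCall P u

/-- The factor of length `n` of a bi-infinite sequence starting at position `i`. -/
def factorAt {A : Type*} (x : ℤ → A) (i : ℤ) (n : ℕ) : List A :=
  (List.range n).map (fun k => x (i + (k : ℤ)))

/-- `w` is a (finite) factor of the bi-infinite sequence `x`. -/
def IsFactorOf {A : Type*} (w : List A) (x : ℤ → A) : Prop :=
  ∃ i : ℤ, w = factorAt x i w.length

/-- A Dyck automaton over alphabet `A` with states `Q`: a labeled graph together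
with a set of matched pairs of edges. -/
structure DyckAutomaton (A : Type*) (Q : Type*) where
  edges : Set (Q × A × Q)
  matched : Set ((Q × A × Q) × (Q × A × Q))

/-- Well-formedness of a Dyck automaton: matched pairs consist of edges of the
automaton, a call edge followed by a return edge. -/
def DyckAutomaton.WellFormed {A Q : Type*} (P : PushdownAlphabet A)
    (𝒜 : DyckAutomaton A Q) : Prop :=
  ∀ e f : Q × A × Q, (e, f) ∈ 𝒜.matched →
    e ∈ 𝒜.edges ∧ f ∈ 𝒜.edges ∧
    P.kind e.2.1 = LetterKind.call ∧ P.kind f.2.1 = LetterKind.ret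

/-- The label of a finite path. -/
def pathLabel {A Q : Type*} (π : List (Q × A × Q)) : List A :=
  π.map (fun e => e.2.1)

/-- A finite path of the underlying graph: a sequence of consecutive edges. -/
def IsPath {A Q : Type*} (𝒜 : DyckAutomaton A Q) (π : List (Q × A × Q)) : Prop :=
  (∀ e ∈ π, e ∈ 𝒜.edges) ∧ π.Chain' (fun e f => e.2.2 = f.1)

/-- A finite path is admissible if for any factor `e · π₁ · f` of it with `e` a call
edge, `f` a return edge and the label of `π₁` a Dyck word, `(e,f)` is a matched pair. -/
def IsAdmissible {A Q : Type*} (P : PushdownAlphabet A) (𝒜 : DyckAutomaton A Q)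
    (π : List (Q × A × Q)) : Prop :=
  IsPath 𝒜 π ∧
  ∀ (π₀ : List (Q × A × Q)) (e : Q × A × Q) (π₁ : List (Q × A × Q)) (f : Q × A × Q)
    (π₂ : List (Q × A × Q)), π = π₀ ++ e :: π₁ ++ f :: π₂ →
    P.kind e.2.1 = LetterKind.call → P.kind f.2.1 = LetterKind.ret →
    IsDyck P (pathLabel π₁) → (e, f) ∈ 𝒜.matched

/-- The finite factor of a bi-infinite path starting at index `i`, of length `n`. -/
def pathSeg {A Q : Type*} (π : ℤ → Q × A × Q) (i : ℤ) (n : ℕ) : List (Q × A × Q) :=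
  (List.range n).map (fun k => π (i + (k : ℤ)))

/-- A bi-infinite path is admissible if it is a bi-infinite path of the graph all of
whose finite factors are admissible. -/
def BiAdmissible {A Q : Type*} (P : PushdownAlphabet A) (𝒜 : DyckAutomaton A Q)
    (π : ℤ → Q × A × Q) : Prop :=
  (∀ i : ℤ, π i ∈ 𝒜.edges) ∧ (∀ i : ℤ, (π i).2.2 = (π (i + 1)).1) ∧
  ∀ (i : ℤ) (n : ℕ), IsAdmissible P 𝒜 (pathSeg π i n)

/-- The sofic-Dyck shift presented by a Dyck automaton: the set of labels of
bi-infinite admissible paths. -/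
def presents {A Q : Type*} (P : PushdownAlphabet A) (𝒜 : DyckAutomaton A Q) :
    Set (ℤ → A) :=
  { x | ∃ π : ℤ → Q × A × Q, BiAdmissible P 𝒜 π ∧ ∀ i : ℤ, (π i).2.1 = x i }

/-- A sofic-Dyck shift over `A`: a set presented by some (finite, well-formed)
Dyck automaton. -/
def IsSoficDyck {A : Type*} (P : PushdownAlphabet A) (X : Set (ℤ → A)) : Prop :=
  ∃ (N : ℕ) (𝒜 : DyckAutomaton A (Fin N)), 𝒜.WellFormed P ∧ X = presents P 𝒜

/-- A finite path goes from `p` to `q` (an empty path goes from `p` to `p`). -/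
def GoesFromTo {A Q : Type*} (π : List (Q × A × Q)) (p q : Q) : Prop :=
  (∀ e ∈ π.head?, e.1 = p) ∧ (∀ e ∈ π.getLast?, e.2.2 = q) ∧ (π = [] → p = q)

/-- A finite path starts at state `p`. -/
def StartsAt {A Q : Type*} (π : List (Q × A × Q)) (p : Q) : Prop :=
  ∀ e ∈ π.head?, e.1 = p

/-- States of the left reduction: pairs of a summary and a set of states. -/
abbrev LRState (Q : Type*) := Set (Q × Q) × Set Q

/-- The initial state `I = (∅, Q)` of the left reduction. -/
def lrInit (Q : Type*) : LRState Q := (∅, Set.univ)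

/-- Successors of a set of states by a letter. -/
def lrSucc {A Q : Type*} (𝒜 : DyckAutomaton A Q) (R : Set Q) (a : A) : Set Q :=
  { q | ∃ p ∈ R, (p, a, q) ∈ 𝒜.edges }

/-- Update of a summary by an internal letter. -/
def lrSuccS {A Q : Type*} (𝒜 : DyckAutomaton A Q) (S : Set (Q × Q)) (a : A) :
    Set (Q × Q) :=
  { pq | ∃ r, (pq.1, r) ∈ S ∧ (r, a, pq.2) ∈ 𝒜.edges }

/-- The diagonal of a set of states. -/
def lrDiag {Q : Type*} (R : Set Q) : Set (Q × Q) :=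
  { pq | pq.1 = pq.2 ∧ pq.1 ∈ R }

/-- Internal edges of the left reduction. -/
def lrInternEdge {A Q : Type*} (P : PushdownAlphabet A) (𝒜 : DyckAutomaton A Q)
    (e : LRState Q × A × LRState Q) : Prop :=
  P.kind e.2.1 = LetterKind.intern ∧ (lrSucc 𝒜 e.1.2 e.2.1).Nonempty ∧
  e.2.2 = (lrSuccS 𝒜 e.1.1 e.2.1, lrSucc 𝒜 e.1.2 e.2.1)

/-- Call edges of the left reduction. -/
def lrCallEdge {A Q : Type*} (P : PushdownAlphabet A) (𝒜 : DyckAutomaton A Q)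
    (e : LRState Q × A × LRState Q) : Prop :=
  P.kind e.2.1 = LetterKind.call ∧ (lrSucc 𝒜 e.1.2 e.2.1).Nonempty ∧
  e.2.2 = (lrDiag (lrSucc 𝒜 e.1.2 e.2.1), lrSucc 𝒜 e.1.2 e.2.1)

/-- The `Update` relation associated with a call letter `a`, a return letter `b` and
a summary `S`. -/
def lrUpdate {A Q : Type*} (𝒜 : DyckAutomaton A Q) (a b : A) (S : Set (Q × Q)) :
    Set (Q × Q) :=
  { pp' | ∃ p₁ p₂, (pp'.1, a, p₁) ∈ 𝒜.edges ∧ (p₁, p₂) ∈ S ∧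
      (p₂, b, pp'.2) ∈ 𝒜.edges ∧ ((pp'.1, a, p₁), (p₂, b, pp'.2)) ∈ 𝒜.matched }

/-- Matched pairs of the left reduction: a call edge `e` together with the return
edge `f` constructed from it by the determinization procedure. -/
def lrMatchedPair {A Q : Type*} (P : PushdownAlphabet A) (𝒜 : DyckAutomaton A Q)
    (e f : LRState Q × A × LRState Q) : Prop :=
  lrCallEdge P 𝒜 e ∧ P.kind f.2.1 = LetterKind.ret ∧
  ({ q | ∃ p ∈ e.1.2, (p, q) ∈ lrUpdate 𝒜 e.2.1 f.2.1 f.1.1 } : Set Q).Nonempty ∧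
  f.2.2 = ({ pq | ∃ p', (pq.1, p') ∈ e.1.1 ∧ (p', pq.2) ∈ lrUpdate 𝒜 e.2.1 f.2.1 f.1.1 },
           { q | ∃ p ∈ e.1.2, (p, q) ∈ lrUpdate 𝒜 e.2.1 f.2.1 f.1.1 })

/-- Unmatched return edges of the left reduction, from states with empty summary. -/
def lrRetBotEdge {A Q : Type*} (P : PushdownAlphabet A) (𝒜 : DyckAutomaton A Q)
    (f : LRState Q × A × LRState Q) : Prop :=
  P.kind f.2.1 = LetterKind.ret ∧ f.1.1 = (∅ : Set (Q × Q)) ∧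
  (lrSucc 𝒜 f.1.2 f.2.1).Nonempty ∧
  f.2.2 = ((∅ : Set (Q × Q)), lrSucc 𝒜 f.1.2 f.2.1)

/-- The left reduction before restriction to reachable states. -/
def leftRedFull {A Q : Type*} (P : PushdownAlphabet A) (𝒜 : DyckAutomaton A Q) :
    DyckAutomaton A (LRState Q) where
  edges := { f | lrInternEdge P 𝒜 f ∨ lrCallEdge P 𝒜 f ∨
    (∃ e, lrMatchedPair P 𝒜 e f) ∨ lrRetBotEdge P 𝒜 f }
  matched := { ef | lrMatchedPair P 𝒜 ef.1 ef.2 }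

/-- A state of the left reduction is reachable if some admissible path goes from the
initial state `I` to it. -/
def lrReachable {A Q : Type*} (P : PushdownAlphabet A) (𝒜 : DyckAutomaton A Q)
    (s : LRState Q) : Prop :=
  ∃ π : List (LRState Q × A × LRState Q),
    IsAdmissible P (leftRedFull P 𝒜) π ∧ GoesFromTo π (lrInit Q) s

/-- The left reduction of a Dyck automaton: only the states reachable from the
initial state are kept. -/
def leftReduction {A Q : Type*} (P : PushdownAlphabet A) (𝒜 : DyckAutomaton A Q) :
    DyckAutomaton A (LRState Q) where
  edges := { f ∈ (leftRedFull P 𝒜).edges | lrReachable P 𝒜 f.1 ∧ lrReachable P 𝒜 f.2.2 }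
  matched := { ef ∈ (leftRedFull P 𝒜).matched |
    lrReachable P 𝒜 ef.1.1 ∧ lrReachable P 𝒜 ef.1.2.2 ∧
    lrReachable P 𝒜 ef.2.1 ∧ lrReachable P 𝒜 ef.2.2.2 }

end SD

namespace SD

section Words

variable {A : Type*} (P : PushdownAlphabet A)

theorem callCount_append (u v : List A) : callCount P (u ++ v) = callCount P u + callCount P v :=
  List.countP_append

theorem retCount_append (u v : List A) : retCount P (u ++ v) = retCount P u + retCount P v :=
  List.countP_append

theorem matchedReturn_iff_take (u : List A) :
    MatchedReturn P u ↔ ∀ k, retCount P (u.take k) ≤ callCount P (u.take k) := by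
  constructor
  · intro h k
    exact h _ (u.drop k) (List.take_append_drop k u).symm
  · rintro h v w rfl
    simpa using h v.length

theorem isDyck_iff (u : List A) :
    IsDyck P u ↔ (∀ k, retCount P (u.take k) ≤ callCount P (u.take k)) ∧
      callCount P u = retCount P u := by
  rw [IsDyck, matchedReturn_iff_take]
  refine and_congr_right fun h => ⟨fun hc => ?_, ?_⟩
  · have h1 := hc [] u rfl
    have h2 := h u.length
    rw [List.take_length] at h2
    omega
  · rintro he v w rfl
    have h1 := h v.length
    rw [List.take_left] at h1
    rw [callCount_append, retCount_append] at he
    omega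

theorem isDyck_nil : IsDyck P [] := by
  simp [isDyck_iff, callCount, retCount]

variable {P}

theorem IsDyck.append {u v : List A} (hu : IsDyck P u) (hv : IsDyck P v) : IsDyck P (u ++ v) := by
  rw [isDyck_iff] at *
  refine ⟨fun k => ?_, ?_⟩
  · rw [List.take_append, callCount_append, retCount_append]
    exact add_le_add (hu.1 _) (hv.1 _)
  · rw [callCount_append, retCount_append, hu.2, hv.2]

theorem isDyck_intern {a : A} (ha : P.kind a = .intern) : IsDyck P [a] := by
  rw [isDyck_iff]
  refine ⟨fun k => ?_, ?_⟩
  · cases k <;> simp [callCount, retCount, ha]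
  · simp [callCount, retCount, ha]

theorem IsDyck.wrap {a b : A} {v : List A} (ha : P.kind a = .call) (hb : P.kind b = .ret)
    (hv : IsDyck P v) : IsDyck P (a :: v ++ [b]) := by
  rw [isDyck_iff] at *
  have hca : callCount P [a] = 1 := by simp [callCount, ha]
  have hra : retCount P [a] = 0 := by simp [retCount, ha]
  have hcb : callCount P [b] = 0 := by simp [callCount, hb]
  have hrb : retCount P [b] = 1 := by simp [retCount, hb]
  have hw : a :: v ++ [b] = [a] ++ (v ++ [b]) := rfl
  rw [hw]
  refine ⟨fun k => ?_, ?_⟩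
  · cases k with
    | zero => simp [callCount, retCount]
    | succ k =>
      have h1 := hv.1 k
      have h2 : retCount P ([b].take (k - v.length)) ≤ 1 := by
        refine (List.Sublist.countP_le (List.take_sublist _ _)).trans hrb.le
      rw [List.singleton_append, List.take_succ_cons, ← List.singleton_append, List.take_append]
      simp only [callCount_append, retCount_append]
      omega
  · simp only [callCount_append, retCount_append]
    have := hv.2
    omega

end Words

section Paths

variable {A Q : Type*} (P : PushdownAlphabet A)

/-- The effect of reading an edge on the stack of pending call edges. -/
def stackStep (st : List (Q × A × Q)) (e : Q × A × Q) : List (Q × A × Q) :=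
  match P.kind e.2.1 with
  | .call => e :: st
  | .ret => st.tail
  | .intern => st

/-- The stack of pending (unmatched) call edges after reading a path. -/
def pendingCalls (π : List (Q × A × Q)) : List (Q × A × Q) :=
  π.foldl (stackStep P) []

theorem pendingCalls_concat (π : List (Q × A × Q)) (f : Q × A × Q) :
    pendingCalls P (π ++ [f]) = stackStep P (pendingCalls P π) f := by
  simp [pendingCalls]

theorem foldl_stackStep_of_matchedReturn (s π : List (Q × A × Q))
    (h : MatchedReturn P (pathLabel π)) :
    ∃ t, π.foldl (stackStep P) s = t ++ s ∧
      t.length + retCount P (pathLabel π) = callCount P (pathLabel π) := by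
  induction π using List.reverseRecOn with
  | nil => exact ⟨[], rfl, by simp [pathLabel, retCount, callCount]⟩
  | append_singleton π f ih =>
    have hl : pathLabel (π ++ [f]) = pathLabel π ++ [f.2.1] := by simp [pathLabel]
    rw [hl] at h ⊢
    obtain ⟨t, ht, hlen⟩ := ih fun v w hvw => h v (w ++ [f.2.1]) (by rw [hvw, List.append_assoc])
    have hle := h _ [] (List.append_nil _).symm
    rw [callCount_append, retCount_append] at hle ⊢
    rw [List.foldl_append, ht]
    simp only [List.foldl_cons, List.foldl_nil, stackStep]
    cases hk : P.kind f.2.1 with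
    | call => exact ⟨f :: t, rfl, by simp [callCount, retCount, hk] at *; omega⟩
    | intern => exact ⟨t, rfl, by simp [callCount, retCount, hk] at *; omega⟩
    | ret =>
      cases t with
      | nil => simp [callCount, retCount, hk] at *; omega
      | cons g t => exact ⟨t, rfl, by simp [callCount, retCount, hk] at *; omega⟩

theorem foldl_stackStep_of_isDyck (s π : List (Q × A × Q)) (h : IsDyck P (pathLabel π)) :
    π.foldl (stackStep P) s = s := by
  obtain ⟨t, ht, hlen⟩ := foldl_stackStep_of_matchedReturn P s π h.1
  have := ((isDyck_iff P _).1 h).2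
  have h0 : t = [] := List.length_eq_zero_iff.1 (by omega)
  rw [ht, h0, List.nil_append]

theorem pendingCalls_of_isDyck (π₀ π₁ : List (Q × A × Q)) (e : Q × A × Q)
    (he : P.kind e.2.1 = .call) (h : IsDyck P (pathLabel π₁)) :
    pendingCalls P (π₀ ++ e :: π₁) = e :: pendingCalls P π₀ := by
  simp only [pendingCalls, List.foldl_append, List.foldl_cons]
  rw [foldl_stackStep_of_isDyck P _ _ h]
  simp [stackStep, he]

theorem exists_of_pendingCalls_eq_cons (n : ℕ) :
    ∀ (π : List (Q × A × Q)), π.length ≤ n → ∀ (e : Q × A × Q) (r : List (Q × A × Q)),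
      pendingCalls P π = e :: r →
      ∃ π₀ π₁, π = π₀ ++ e :: π₁ ∧ P.kind e.2.1 = .call ∧ IsDyck P (pathLabel π₁) ∧
        pendingCalls P π₀ = r := by
  induction n with
  | zero =>
    intro π hn e r h
    rw [List.length_eq_zero_iff.1 (Nat.le_zero.1 hn)] at h
    simp [pendingCalls] at h
  | succ n ih =>
    intro π hn e r h
    rcases List.eq_nil_or_concat π with rfl | ⟨π', f, rfl⟩
    · simp [pendingCalls] at h
    rw [List.concat_eq_append] at *
    rw [List.length_append, List.length_singleton] at hn
    rw [pendingCalls_concat, stackStep] at h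
    cases hk : P.kind f.2.1 with
    | call =>
      simp only [hk, List.cons.injEq] at h
      obtain ⟨rfl, rfl⟩ := h
      exact ⟨π', [], rfl, hk, isDyck_nil P, rfl⟩
    | intern =>
      simp only [hk] at h
      obtain ⟨π₀, π₁, rfl, he, hd, hr⟩ := ih π' (by omega) e r h
      refine ⟨π₀, π₁ ++ [f], by simp, he, ?_, hr⟩
      simpa [pathLabel] using hd.append (isDyck_intern hk)
    | ret =>
      simp only [hk] at h
      cases hp : pendingCalls P π' with
      | nil => simp [hp] at h
      | cons g r' =>
        rw [hp, List.tail_cons] at h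
        subst h
        obtain ⟨π₀, π₁, rfl, hg, hd, hr⟩ := ih π' (by omega) g _ hp
        obtain ⟨ρ₀, ρ₁, rfl, he, hd', hr'⟩ := ih π₀ (by simp at hn; omega) e r hr
        refine ⟨ρ₀, ρ₁ ++ (g :: π₁ ++ [f]), by simp, he, ?_, hr'⟩
        have := hd'.append (hd.wrap hg hk)
        simpa [pathLabel] using this

variable (𝒜 : DyckAutomaton A Q)

theorem IsAdmissible.of_append {P : PushdownAlphabet A} {𝒜 : DyckAutomaton A Q}
    {α π β : List (Q × A × Q)} (h : IsAdmissible P 𝒜 (α ++ π ++ β)) : IsAdmissible P 𝒜 π := by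
  refine ⟨⟨fun e he => h.1.1 e (by simp [he]), h.1.2.left_of_append.right_of_append⟩, ?_⟩
  rintro π₀ e π₁ f π₂ rfl
  exact h.2 (α ++ π₀) e π₁ f (π₂ ++ β) (by simp)

theorem isAdmissible_nil : IsAdmissible P 𝒜 [] :=
  ⟨⟨by simp, List.isChain_nil⟩, by simp⟩

theorem isAdmissible_concat_iff (π : List (Q × A × Q)) (f : Q × A × Q) :
    IsAdmissible P 𝒜 (π ++ [f]) ↔
      IsAdmissible P 𝒜 π ∧ f ∈ 𝒜.edges ∧ (∀ e ∈ π.getLast?, e.2.2 = f.1) ∧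
        (P.kind f.2.1 = .ret → ∀ e ∈ (pendingCalls P π).head?, (e, f) ∈ 𝒜.matched) := by
  constructor
  · intro h
    refine ⟨IsAdmissible.of_append (α := []) h, h.1.1 f (by simp), ?_, fun hf e he => ?_⟩
    · have := (List.isChain_append.1 h.1.2).2.2
      intro e he
      exact this e he f (by simp)
    · obtain ⟨r, hr⟩ := List.head?_eq_some_iff.1 he
      obtain ⟨π₀, π₁, rfl, hk, hd, -⟩ := exists_of_pendingCalls_eq_cons P _ π le_rfl e r hr
      exact h.2 π₀ e π₁ f [] rfl hk hf hd
  · rintro ⟨h, hf, hl, hm⟩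
    refine ⟨⟨?_, ?_⟩, ?_⟩
    · intro e he
      rcases List.mem_append.1 he with he | he
      · exact h.1.1 e he
      · rwa [List.mem_singleton.1 he]
    · refine List.isChain_append.2 ⟨h.1.2, List.isChain_singleton _, ?_⟩
      intro e he g hg
      rw [List.head?_cons, Option.mem_some_iff] at hg
      exact hg ▸ hl e he
    · intro π₀ e π₁ g π₂ heq he hg hd
      rcases List.eq_nil_or_concat π₂ with rfl | ⟨π₂', f', rfl⟩
      · obtain ⟨rfl, h2⟩ := List.append_inj' heq rfl
        obtain rfl : f = g := by simpa using h2
        exact hm hg e (by rw [pendingCalls_of_isDyck P _ _ _ he hd]; rfl)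
      · rw [List.concat_eq_append, ← List.cons_append, ← List.append_assoc] at heq
        obtain ⟨rfl, -⟩ := List.append_inj' heq rfl
        exact h.2 π₀ e π₁ g π₂' rfl he hg hd

theorem goesFromTo_concat_iff (π : List (Q × A × Q)) (f : Q × A × Q) (p q : Q) :
    ((∀ e ∈ π.getLast?, e.2.2 = f.1) ∧ GoesFromTo (π ++ [f]) p q) ↔
      GoesFromTo π p f.1 ∧ f.2.2 = q := by
  cases π with
  | nil => simp [GoesFromTo, eq_comm]
  | cons e π =>
    have h : (e :: (π ++ [f])).getLast? = some f := by
      rw [← List.cons_append, List.getLast?_append]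
      rfl
    simp only [GoesFromTo, List.cons_append, h]
    simp
    tauto

/-- `Run P 𝒜 p w q st`: some admissible path from `p` to `q` is labeled by `w` and leaves the
stack `st` of pending call edges. -/
inductive Run (p : Q) : List A → Q → List (Q × A × Q) → Prop
  | nil : Run p [] p []
  | intern {w : List A} {q : Q} {st : List (Q × A × Q)} {a : A} {q' : Q} :
      Run p w q st → P.kind a = .intern → (q, a, q') ∈ 𝒜.edges → Run p (w ++ [a]) q' st
  | call {w : List A} {q : Q} {st : List (Q × A × Q)} {a : A} {q' : Q} :
      Run p w q st → P.kind a = .call → (q, a, q') ∈ 𝒜.edges →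
        Run p (w ++ [a]) q' ((q, a, q') :: st)
  | retBot {w : List A} {q : Q} {b : A} {q' : Q} :
      Run p w q [] → P.kind b = .ret → (q, b, q') ∈ 𝒜.edges → Run p (w ++ [b]) q' []
  | ret {w : List A} {q : Q} {e : Q × A × Q} {st : List (Q × A × Q)} {b : A} {q' : Q} :
      Run p w q (e :: st) → P.kind b = .ret → (q, b, q') ∈ 𝒜.edges →
        (e, (q, b, q')) ∈ 𝒜.matched → Run p (w ++ [b]) q' st

variable {P 𝒜}

theorem Run.exists_path {p q : Q} {w : List A} {st : List (Q × A × Q)} (h : Run P 𝒜 p w q st) :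
    ∃ π, IsAdmissible P 𝒜 π ∧ GoesFromTo π p q ∧ pathLabel π = w ∧ pendingCalls P π = st := by
  have extend : ∀ {π : List (Q × A × Q)} {q : Q} {a : A} {q' : Q},
      IsAdmissible P 𝒜 π → GoesFromTo π p q → (q, a, q') ∈ 𝒜.edges →
      (P.kind a = .ret → ∀ e ∈ (pendingCalls P π).head?, (e, (q, a, q')) ∈ 𝒜.matched) →
      ∃ π', IsAdmissible P 𝒜 π' ∧ GoesFromTo π' p q' ∧ pathLabel π' = pathLabel π ++ [a] ∧
        pendingCalls P π' = stackStep P (pendingCalls P π) (q, a, q') := by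
    intro π q a q' hπ hg he hm
    obtain ⟨h1, h2⟩ := (goesFromTo_concat_iff π (q, a, q') p q').2 ⟨hg, rfl⟩
    exact ⟨π ++ [(q, a, q')], (isAdmissible_concat_iff P 𝒜 _ _).2 ⟨hπ, he, h1, hm⟩, h2,
      by simp [pathLabel], pendingCalls_concat P _ _⟩
  induction h with
  | nil => exact ⟨[], isAdmissible_nil P 𝒜, by simp [GoesFromTo], rfl, rfl⟩
  | intern _ hk he ih =>
    obtain ⟨π, hπ, hg, rfl, rfl⟩ := ih
    obtain ⟨π', h1, h2, h3, h4⟩ := extend hπ hg he (by simp [hk])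
    exact ⟨π', h1, h2, h3, by simpa [stackStep, hk] using h4⟩
  | call _ hk he ih =>
    obtain ⟨π, hπ, hg, rfl, rfl⟩ := ih
    obtain ⟨π', h1, h2, h3, h4⟩ := extend hπ hg he (by simp [hk])
    exact ⟨π', h1, h2, h3, by simpa [stackStep, hk] using h4⟩
  | retBot _ hk he ih =>
    obtain ⟨π, hπ, hg, rfl, hs⟩ := ih
    obtain ⟨π', h1, h2, h3, h4⟩ := extend hπ hg he (by simp [hs])
    exact ⟨π', h1, h2, h3, by simpa [stackStep, hk, hs] using h4⟩
  | ret _ hk he hm ih =>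
    obtain ⟨π, hπ, hg, rfl, hs⟩ := ih
    obtain ⟨π', h1, h2, h3, h4⟩ := extend hπ hg he (by simpa [hs] using fun _ => hm)
    exact ⟨π', h1, h2, h3, by simpa [stackStep, hk, hs] using h4⟩

theorem IsAdmissible.run {π : List (Q × A × Q)} {p q : Q} (h : IsAdmissible P 𝒜 π)
    (hg : GoesFromTo π p q) : Run P 𝒜 p (pathLabel π) q (pendingCalls P π) := by
  induction π using List.reverseRecOn generalizing q with
  | nil =>
    obtain rfl := hg.2.2 rfl
    exact .nil
  | append_singleton π f ih =>
    obtain ⟨hπ, hf, hl, hm⟩ := (isAdmissible_concat_iff P 𝒜 π f).1 h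
    obtain ⟨hg', rfl⟩ := (goesFromTo_concat_iff π f p q).1 ⟨hl, hg⟩
    have hr := ih hπ hg'
    have hlab : pathLabel (π ++ [f]) = pathLabel π ++ [f.2.1] := by simp [pathLabel]
    rw [hlab, pendingCalls_concat, stackStep]
    cases hk : P.kind f.2.1 with
    | call => exact hr.call hk hf
    | intern => exact hr.intern hk hf
    | ret =>
      cases hs : pendingCalls P π with
      | nil => exact (hs ▸ hr).retBot hk hf
      | cons e st => exact (hs ▸ hr).ret hk hf (hm hk e (by simp [hs]))

theorem exists_run_of_isAdmissible {π : List (Q × A × Q)} (h : IsAdmissible P 𝒜 π)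
    (hne : π ≠ []) : ∃ p q st, Run P 𝒜 p (pathLabel π) q st :=
  ⟨_, _, _, h.run (p := (π.head hne).1) (q := (π.getLast hne).2.2)
    ⟨by simp [List.head?_eq_some_head hne], by simp [List.getLast?_eq_some_getLast hne],
      fun h0 => absurd h0 hne⟩⟩

end Paths

section LeftReduction

variable {A Q : Type*} {P : PushdownAlphabet A} {𝒜 : DyckAutomaton A Q}

theorem lrReachable_iff (s : LRState Q) :
    lrReachable P 𝒜 s ↔ ∃ w st, Run P (leftRedFull P 𝒜) (lrInit Q) w s st := by
  constructor
  · rintro ⟨π, hπ, hg⟩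
    exact ⟨_, _, hπ.run hg⟩
  · rintro ⟨w, st, h⟩
    obtain ⟨π, hπ, hg, -⟩ := h.exists_path
    exact ⟨π, hπ, hg⟩

theorem Run.leftReduction {w : List A} {s : LRState Q}
    {st : List (LRState Q × A × LRState Q)}
    (h : Run P (leftRedFull P 𝒜) (lrInit Q) w s st) :
    Run P (leftReduction P 𝒜) (lrInit Q) w s st ∧ ∀ e ∈ st, e ∈ (leftReduction P 𝒜).edges := by
  have reach : ∀ {w : List A} {s : LRState Q} {st : List (LRState Q × A × LRState Q)},
      Run P (leftRedFull P 𝒜) (lrInit Q) w s st → lrReachable P 𝒜 s :=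
    fun h => (lrReachable_iff _).2 ⟨_, _, h⟩
  induction h with
  | nil => exact ⟨.nil, by simp⟩
  | intern h hk he ih =>
    exact ⟨ih.1.intern hk ⟨he, reach h, reach (h.intern hk he)⟩, ih.2⟩
  | call h hk he ih =>
    have he' : _ ∈ (SD.leftReduction P 𝒜).edges := ⟨he, reach h, reach (h.call hk he)⟩
    exact ⟨ih.1.call hk he', List.forall_mem_cons.2 ⟨he', ih.2⟩⟩
  | retBot h hk he ih =>
    exact ⟨ih.1.retBot hk ⟨he, reach h, reach (h.retBot hk he)⟩, by simp⟩
  | ret h hk he hm ih =>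
    have h1 := reach h
    have h2 := reach (h.ret hk he hm)
    have h3 := ih.2 _ List.mem_cons_self
    exact ⟨ih.1.ret hk ⟨he, h1, h2⟩ ⟨hm, h3.2.1, h3.2.2, h1, h2⟩,
      fun e he => ih.2 e (List.mem_cons_of_mem _ he)⟩

/-- In every state along a stack of pending calls, the summary has its range in the state set,
and the summary below the bottom of the stack is empty. -/
def SummaryInRange : LRState Q → List (LRState Q × A × LRState Q) → Prop
  | s, [] => s.1 = ∅
  | s, e :: st => SummaryInRange e.1 st ∧ ∀ p q, (p, q) ∈ s.1 → q ∈ s.2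

theorem SummaryInRange.mem {s : LRState Q} {st : List (LRState Q × A × LRState Q)}
    (h : SummaryInRange s st) {p q : Q} (hpq : (p, q) ∈ s.1) : q ∈ s.2 := by
  cases st with
  | nil =>
    have h' : s.1 = ∅ := h
    simp [h'] at hpq
  | cons e st => exact h.2 p q hpq

theorem not_lrMatchedPair_of_summary_eq_empty {e f : LRState Q × A × LRState Q}
    (hf : f.1.1 = ∅) : ¬ lrMatchedPair P 𝒜 e f := by
  rintro ⟨-, -, ⟨q, p, -, p₁, p₂, -, hp, -⟩, -⟩
  simp [hf] at hp

theorem Run.summaryInRange {w : List A} {s : LRState Q}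
    {st : List (LRState Q × A × LRState Q)}
    (h : Run P (leftRedFull P 𝒜) (lrInit Q) w s st) : SummaryInRange s st := by
  induction h with
  | nil => exact rfl
  | @intern w s st a s' _ hk he ih =>
    rcases he with ⟨-, -, he⟩ | ⟨hk', -⟩ | ⟨e, -, hk', -⟩ | ⟨hk', -⟩
    · dsimp only at he
      subst he
      cases st with
      | nil =>
        have h0 : s.1 = ∅ := ih
        ext
        simp [lrSuccS, h0]
      | cons e st =>
        refine ⟨ih.1, ?_⟩
        rintro p q ⟨r, hr, hq⟩
        exact ⟨r, ih.2 _ _ hr, hq⟩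
    all_goals simp [hk] at hk'
  | @call w s st a s' _ hk he ih =>
    rcases he with ⟨hk', -⟩ | ⟨-, -, he⟩ | ⟨e, -, hk', -⟩ | ⟨hk', -⟩
    case inr.inl =>
      dsimp only at he
      subst he
      refine ⟨ih, ?_⟩
      rintro p q ⟨h, hp⟩
      obtain rfl : p = q := h
      exact hp
    all_goals simp [hk] at hk'
  | @retBot w s b s' _ hk he ih =>
    rcases he with ⟨hk', -⟩ | ⟨hk', -⟩ | ⟨e, he⟩ | ⟨-, -, -, he⟩
    case inr.inr.inl => exact absurd he (not_lrMatchedPair_of_summary_eq_empty ih)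
    case inr.inr.inr =>
      dsimp only at he
      subst he
      exact rfl
    all_goals simp [hk] at hk'
  | @ret w s e st b s' _ hk he hm ih =>
    obtain ⟨-, -, -, he⟩ := hm
    dsimp only at he
    subst he
    cases st with
    | nil =>
      have h0 : e.1.1 = ∅ := ih.1
      ext
      simp [h0]
    | cons e' st =>
      refine ⟨ih.1.1, ?_⟩
      rintro p q ⟨p', hp, hu⟩
      exact ⟨p', ih.1.2 _ _ hp, hu⟩

theorem lrReachable.mem {s : LRState Q} (h : lrReachable P 𝒜 s) {p q : Q} (hpq : (p, q) ∈ s.1) :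
    q ∈ s.2 := by
  obtain ⟨w, st, h⟩ := (lrReachable_iff s).1 h
  exact h.summaryInRange.mem hpq

/-- A configuration (state and stack) of the left reduction simulates one of the original
automaton. -/
def Simulates (P : PushdownAlphabet A) (𝒜 : DyckAutomaton A Q) :
    Q → List (Q × A × Q) → LRState Q → List (LRState Q × A × LRState Q) → Prop
  | q, [], s, [] => s.1 = ∅ ∧ q ∈ s.2
  | q, e :: st, s, E :: St => Simulates P 𝒜 e.1 st E.1 St ∧ lrCallEdge P 𝒜 E ∧
      E.2.1 = e.2.1 ∧ e ∈ 𝒜.edges ∧ (e.2.2, q) ∈ s.1 ∧ q ∈ s.2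
  | _, _, _, _ => False

theorem Simulates.mem {q : Q} {st : List (Q × A × Q)} {s : LRState Q}
    {St : List (LRState Q × A × LRState Q)} (h : Simulates P 𝒜 q st s St) : q ∈ s.2 := by
  rcases st with _ | ⟨e, st⟩ <;> rcases St with _ | ⟨E, St⟩
  · exact h.2
  · exact h.elim
  · exact h.elim
  · exact h.2.2.2.2.2

theorem Run.exists_simulates {p q : Q} {w : List A} {st : List (Q × A × Q)}
    (h : Run P 𝒜 p w q st) :
    ∃ s St, Run P (leftRedFull P 𝒜) (lrInit Q) w s St ∧ Simulates P 𝒜 q st s St := by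
  induction h with
  | nil => exact ⟨lrInit Q, [], .nil, rfl, trivial⟩
  | @intern w q st a q' _ hk he ih =>
    obtain ⟨s, St, hr, hs⟩ := ih
    have hq : q' ∈ lrSucc 𝒜 s.2 a := ⟨q, hs.mem, he⟩
    refine ⟨(lrSuccS 𝒜 s.1 a, lrSucc 𝒜 s.2 a), St, hr.intern hk (.inl ⟨hk, ⟨q', hq⟩, rfl⟩), ?_⟩
    rcases st with _ | ⟨e, st⟩ <;> rcases St with _ | ⟨E, St⟩
    · refine ⟨?_, hq⟩
      ext
      simp [lrSuccS, hs.1]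
    · exact hs.elim
    · exact hs.elim
    · obtain ⟨h1, h2, h3, h4, h5, -⟩ := hs
      exact ⟨h1, h2, h3, h4, ⟨q, h5, he⟩, hq⟩
  | @call w q st a q' _ hk he ih =>
    obtain ⟨s, St, hr, hs⟩ := ih
    have hq : q' ∈ lrSucc 𝒜 s.2 a := ⟨q, hs.mem, he⟩
    have hE : lrCallEdge P 𝒜 (s, a, (lrDiag (lrSucc 𝒜 s.2 a), lrSucc 𝒜 s.2 a)) :=
      ⟨hk, ⟨q', hq⟩, rfl⟩
    exact ⟨_, _, hr.call hk (.inr (.inl hE)), hs, hE, rfl, he, ⟨rfl, hq⟩, hq⟩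
  | @retBot w q b q' _ hk he ih =>
    obtain ⟨s, _ | ⟨E, St⟩, hr, hs⟩ := ih
    · have hq : q' ∈ lrSucc 𝒜 s.2 b := ⟨q, hs.2, he⟩
      exact ⟨(∅, lrSucc 𝒜 s.2 b), [],
        hr.retBot hk (.inr (.inr (.inr ⟨hk, hs.1, ⟨q', hq⟩, rfl⟩))), rfl, hq⟩
    · exact hs.elim
  | @ret w q e st b q' _ hk he hm ih =>
    obtain ⟨s, _ | ⟨E, St⟩, hr, hs⟩ := ih
    · exact hs.elim
    obtain ⟨h1, h2, h3, h4, h5, -⟩ := hs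
    have hu : (e.1, q') ∈ lrUpdate 𝒜 E.2.1 b s.1 := by
      rw [h3]
      exact ⟨e.2.2, q, h4, h5, he, hm⟩
    have hq : ∃ p ∈ E.1.2, (p, q') ∈ lrUpdate 𝒜 E.2.1 b s.1 := ⟨e.1, h1.mem, hu⟩
    have hM : lrMatchedPair P 𝒜 E (s, b,
        { pq | ∃ p', (pq.1, p') ∈ E.1.1 ∧ (p', pq.2) ∈ lrUpdate 𝒜 E.2.1 b s.1 },
        { q | ∃ p ∈ E.1.2, (p, q) ∈ lrUpdate 𝒜 E.2.1 b s.1 }) := ⟨h2, hk, ⟨q', hq⟩, rfl⟩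
    refine ⟨_, St, hr.ret hk (.inr (.inr (.inl ⟨E, hM⟩))) hM, ?_⟩
    rcases st with _ | ⟨e', st⟩ <;> rcases St with _ | ⟨E', St⟩
    · refine ⟨?_, hq⟩
      ext
      simp [h1.1]
    · exact h1.elim
    · exact h1.elim
    · obtain ⟨g1, g2, g3, g4, g5, -⟩ := h1
      exact ⟨g1, g2, g3, g4, ⟨e.1, g5, hu⟩, hq⟩

/-- Every configuration of the original automaton described by the given configuration of the left
reduction is the end of a run labeled by the given word. -/
def Liftable (P : PushdownAlphabet A) (𝒜 : DyckAutomaton A Q) :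
    List A → LRState Q → List (LRState Q × A × LRState Q) → Prop
  | w, s, [] => ∀ q ∈ s.2, ∃ p, Run P 𝒜 p w q []
  | w, s, E :: St => ∃ u, Liftable P 𝒜 u E.1 St ∧ lrCallEdge P 𝒜 E ∧
      (∀ p₁ q, (p₁, q) ∈ s.1 → ∀ p p₀ st, Run P 𝒜 p u p₀ st → (p₀, E.2.1, p₁) ∈ 𝒜.edges →
        Run P 𝒜 p w q ((p₀, E.2.1, p₁) :: st)) ∧
      ∀ q ∈ s.2, ∃ p₁ ∈ E.2.2.2, (p₁, q) ∈ s.1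

theorem Liftable.exists_run {w : List A} {s : LRState Q} {St : List (LRState Q × A × LRState Q)}
    (h : Liftable P 𝒜 w s St) {q : Q} (hq : q ∈ s.2) : ∃ p st, Run P 𝒜 p w q st := by
  induction St generalizing w s q with
  | nil =>
    obtain ⟨p, hp⟩ := h q hq
    exact ⟨p, [], hp⟩
  | cons E St ih =>
    obtain ⟨u, hu, ⟨-, -, hE⟩, hrun, hcov⟩ := h
    obtain ⟨p₁, hp₁, hpq⟩ := hcov q hq
    rw [hE] at hp₁
    obtain ⟨p₀, hp₀, he⟩ := hp₁
    obtain ⟨p, st, hp⟩ := ih hu hp₀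
    exact ⟨p, _, hrun p₁ q hpq p p₀ st hp he⟩

theorem Run.liftable {w : List A} {s₀ s : LRState Q}
    {St : List (LRState Q × A × LRState Q)}
    (h : Run P (SD.leftReduction P 𝒜) s₀ w s St) : Liftable P 𝒜 w s St := by
  induction h with
  | nil => exact fun q _ => ⟨q, .nil⟩
  | @intern w s St a s' _ hk he ih =>
    rcases he.1 with ⟨-, -, he⟩ | ⟨hk', -⟩ | ⟨e, -, hk', -⟩ | ⟨hk', -⟩
    · dsimp only at he
      subst he
      cases St with
      | nil =>
        rintro q ⟨r, hr, he⟩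
        obtain ⟨p, hp⟩ := ih r hr
        exact ⟨p, hp.intern hk he⟩
      | cons E St =>
        obtain ⟨u, hu, hE, hrun, hcov⟩ := ih
        refine ⟨u, hu, hE, ?_, ?_⟩
        · rintro p₁ q ⟨r, hr, he⟩ p p₀ st hp hp₀
          exact (hrun p₁ r hr p p₀ st hp hp₀).intern hk he
        · rintro q ⟨r, hr, he⟩
          obtain ⟨p₁, hp₁, h⟩ := hcov r hr
          exact ⟨p₁, hp₁, r, h, he⟩
    all_goals simp [hk] at hk'
  | @call w s St a s' _ hk he ih =>
    rcases he.1 with ⟨hk', -⟩ | he | ⟨e, -, hk', -⟩ | ⟨hk', -⟩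
    case inr.inl =>
      have hs := he.2.2
      dsimp only at hs
      subst hs
      refine ⟨w, ih, he, ?_, fun q hq => ⟨q, hq, rfl, hq⟩⟩
      rintro p₁ q ⟨h, -⟩ p p₀ st hp hp₀
      obtain rfl : p₁ = q := h
      exact hp.call hk hp₀
    all_goals simp [hk] at hk'
  | @retBot w s b s' _ hk he ih =>
    have step : ∀ q' ∈ s'.2, ∃ q ∈ s.2, (q, b, q') ∈ 𝒜.edges := by
      rcases he.1 with ⟨hk', -⟩ | ⟨hk', -⟩ | ⟨e, -, -, -, he'⟩ | ⟨-, -, -, he'⟩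
      case inr.inr.inl =>
        dsimp only at he'
        subst he'
        rintro q' ⟨p, -, p₁, p₂, -, hp, hb, -⟩
        exact ⟨p₂, he.2.1.mem hp, hb⟩
      case inr.inr.inr =>
        dsimp only at he'
        subst he'
        exact fun q' hq' => hq'
      all_goals simp [hk] at hk'
    intro q' hq'
    obtain ⟨q, hq, hb⟩ := step q' hq'
    obtain ⟨p, hp⟩ := ih q hq
    exact ⟨p, hp.retBot hk hb⟩
  | @ret w s E St b s' _ hk he hm ih =>
    obtain ⟨u, hu, hE, hrun, hcov⟩ := ih
    obtain ⟨-, -, -, he'⟩ := hm.1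
    dsimp only at he'
    subst he'
    cases St with
    | nil =>
      rintro q' ⟨p₀, hp₀, p₁, p₂, ha, hS, hb, hM⟩
      obtain ⟨p, hp⟩ := hu p₀ hp₀
      exact ⟨p, (hrun p₁ p₂ hS p p₀ [] hp ha).ret hk hb hM⟩
    | cons E' St =>
      obtain ⟨u', hu', hE', hrun', hcov'⟩ := hu
      refine ⟨u', hu', hE', ?_, ?_⟩
      · rintro r₁ q' ⟨p₀, hp₀, p₁, p₂, ha, hS, hb, hM⟩ p r₀ st hp hr₀
        exact (hrun p₁ p₂ hS p p₀ _ (hrun' r₁ p₀ hp₀ p r₀ st hp hr₀) ha).ret hk hb hM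
      · rintro q' ⟨p₀, hp₀, hU⟩
        obtain ⟨r₁, hr₁, h⟩ := hcov' p₀ hp₀
        exact ⟨r₁, hr₁, p₀, h, hU⟩

theorem nonempty_of_mem_leftRedFull_edges {f : LRState Q × A × LRState Q}
    (hf : f ∈ (leftRedFull P 𝒜).edges) : f.2.2.2.Nonempty := by
  rcases hf with ⟨-, h, he⟩ | ⟨-, h, he⟩ | ⟨e, -, -, h, he⟩ | ⟨-, -, h, he⟩ <;> rwa [he]

theorem Run.state_nonempty {w : List A} {s₀ s : LRState Q}
    {St : List (LRState Q × A × LRState Q)}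
    (h : Run P (SD.leftReduction P 𝒜) s₀ w s St) (hw : w ≠ []) : s.2.Nonempty := by
  cases h with
  | nil => exact absurd rfl hw
  | intern _ _ he => exact nonempty_of_mem_leftRedFull_edges he.1
  | call _ _ he => exact nonempty_of_mem_leftRedFull_edges he.1
  | retBot _ _ he => exact nonempty_of_mem_leftRedFull_edges he.1
  | ret _ _ he => exact nonempty_of_mem_leftRedFull_edges he.1

/-- An automaton and its left reduction have the same labels of finite admissible paths. -/
theorem exists_admissible_iff_leftReduction (P : PushdownAlphabet A) (𝒜 : DyckAutomaton A Q)
    (w : List A) :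
    (∃ π, IsAdmissible P 𝒜 π ∧ pathLabel π = w) ↔
      ∃ π, IsAdmissible P (SD.leftReduction P 𝒜) π ∧ pathLabel π = w := by
  constructor
  · rintro ⟨π, hπ, rfl⟩
    rcases eq_or_ne π [] with rfl | hne
    · exact ⟨[], isAdmissible_nil P _, rfl⟩
    obtain ⟨p, q, st, hr⟩ := exists_run_of_isAdmissible hπ hne
    obtain ⟨s, St, hr', -⟩ := hr.exists_simulates
    obtain ⟨π', h1, -, h2, -⟩ := hr'.leftReduction.1.exists_path
    exact ⟨π', h1, h2⟩
  · rintro ⟨π, hπ, rfl⟩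
    rcases eq_or_ne π [] with rfl | hne
    · exact ⟨[], isAdmissible_nil P _, rfl⟩
    obtain ⟨s₀, s, St, hr⟩ := exists_run_of_isAdmissible hπ hne
    obtain ⟨q, hq⟩ := hr.state_nonempty (by simpa [pathLabel] using hne)
    obtain ⟨p, st, hr'⟩ := hr.liftable.exists_run hq
    obtain ⟨π', h1, -, h2, -⟩ := hr'.exists_path
    exact ⟨π', h1, h2⟩

end LeftReduction

section BiInfinite

variable {A Q : Type*} {P : PushdownAlphabet A} {𝒜 : DyckAutomaton A Q}

theorem pathSeg_eq_map (π : ℤ → Q × A × Q) (i : ℤ) (n : ℕ) :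
    pathSeg π i n = (List.range n).map fun k : ℕ => π (i + (k : ℤ)) := by
  simp [pathSeg, ← List.map_eq_flatMap, Function.comp_def]

theorem factorAt_eq_map (x : ℤ → A) (i : ℤ) (n : ℕ) :
    factorAt x i n = (List.range n).map fun k : ℕ => x (i + (k : ℤ)) := by
  simp [factorAt, ← List.map_eq_flatMap, Function.comp_def]

theorem pathSeg_add (π : ℤ → Q × A × Q) (i : ℤ) (m n : ℕ) :
    pathSeg π i (m + n) = pathSeg π i m ++ pathSeg π (i + m) n := by
  simp [pathSeg_eq_map, List.range_add, add_assoc, Function.comp_def]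

theorem IsAdmissible.pathSeg_of_le {π : ℤ → Q × A × Q} {i j : ℤ} {m n : ℕ}
    (h : IsAdmissible P 𝒜 (pathSeg π i n)) (hij : i ≤ j) (hn : j + m ≤ i + n) :
    IsAdmissible P 𝒜 (pathSeg π j m) := by
  obtain ⟨a, rfl⟩ : ∃ a : ℕ, j = i + a := ⟨(j - i).toNat, by omega⟩
  obtain ⟨b, rfl⟩ : ∃ b : ℕ, n = a + m + b := ⟨n - (a + m), by omega⟩
  rw [pathSeg_add, pathSeg_add] at h
  exact h.of_append

theorem biAdmissible_of_forall_pathSeg {π : ℤ → Q × A × Q}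
    (h : ∀ i n, IsAdmissible P 𝒜 (pathSeg π i n)) : BiAdmissible P 𝒜 π := by
  refine ⟨fun i => ?_, fun i => ?_, h⟩
  · exact (h i 1).1.1 _ (by simp [pathSeg_eq_map])
  · have := (h i 2).1.2
    rw [pathSeg_eq_map] at this
    have := List.isChain_cons_cons.1 this
    simpa using this.1

/-- By compactness, a sequence is in the shift presented by a finite automaton if and only if each
of its finite factors is the label of an admissible path. -/
theorem mem_presents_iff [Finite A] [Finite Q] (x : ℤ → A) :
    x ∈ presents P 𝒜 ↔
      ∀ i n, ∃ π, IsAdmissible P 𝒜 π ∧ pathLabel π = factorAt x i n := by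
  constructor
  · rintro ⟨π, hπ, hx⟩ i n
    exact ⟨pathSeg π i n, hπ.2.2 i n, by simp [pathLabel, pathSeg_eq_map, factorAt_eq_map, hx]⟩
  intro h
  have : ∀ n : ℕ, ∃ π : ℤ → Q × A × Q, IsAdmissible P 𝒜 (pathSeg π (-n) (2 * n + 1)) ∧
      ∀ k : ℤ, -n ≤ k → k ≤ n → (π k).2.1 = x k := by
    intro n
    obtain ⟨π, hπ, hl⟩ := h (-n) (2 * n + 1)
    have hlen : π.length = 2 * n + 1 := by
      simpa [pathLabel, factorAt_eq_map] using congrArg List.length hl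
    have d : Q × A × Q := π[0]
    have hseg : pathSeg (fun k => π.getD (k + n).toNat d) (-n) (2 * n + 1) = π := by
      refine List.ext_getElem (by simp [pathSeg_eq_map, hlen]) fun k h1 h2 => ?_
      simp [pathSeg_eq_map, h2]
    refine ⟨fun k => π.getD (k + n).toNat d, hseg.symm ▸ hπ, fun k h1 h2 => ?_⟩
    have hk : (k + n).toNat < π.length := by omega
    have hget : (pathLabel π)[(k + n).toNat]? = (factorAt x (-n) (2 * n + 1))[(k + n).toNat]? := by
      rw [hl]
    have hk' : (k + n).toNat < 2 * n + 1 := by omega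
    have hcast : -(n : ℤ) + ((k + n).toNat : ℤ) = k := by omega
    rw [factorAt_eq_map, pathLabel, List.getElem?_map, List.getElem?_map,
      List.getElem?_range hk', List.getElem?_eq_getElem hk, Option.map_some, Option.map_some,
      Option.some_inj, hcast] at hget
    simp only [← hget, List.getD_eq_getElem _ _ hk]
  choose π hπ hlab using this
  have hlim : ∀ k : ℤ, ∃ e, ∀ᶠ n in (Filter.hyperfilter ℕ : Filter ℕ), π n k = e := by
    intro k
    obtain ⟨e, he⟩ := ((Filter.hyperfilter ℕ).map fun n => π n k).eq_pure_of_finite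
    refine ⟨e, ?_⟩
    have : ({e} : Set _) ∈ (Filter.hyperfilter ℕ).map fun n => π n k := by
      rw [he]
      exact Set.mem_singleton e
    exact this
  choose ρ hρ using hlim
  have hlarge : ∀ m : ℕ, ∀ᶠ n in (Filter.hyperfilter ℕ : Filter ℕ), m ≤ n := fun m =>
    Nat.hyperfilter_le_atTop (Filter.eventually_ge_atTop m)
  refine ⟨ρ, biAdmissible_of_forall_pathSeg fun i m => ?_, fun k => ?_⟩
  · have hall : ∀ᶠ n in (Filter.hyperfilter ℕ : Filter ℕ),
        ∀ k ∈ Finset.range m, π n (i + k) = ρ (i + k) :=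
      (Filter.eventually_all_finset _).2 fun k _ => hρ _
    obtain ⟨n, hn, hle⟩ := (hall.and (hlarge (i.natAbs + m))).exists
    have heq : pathSeg ρ i m = pathSeg (π n) i m := by
      rw [pathSeg_eq_map, pathSeg_eq_map]
      refine List.map_congr_left fun k hk => (hn k ?_).symm
      simpa using hk
    rw [heq]
    exact (hπ n).pathSeg_of_le (by omega) (by push_cast; omega)
  · obtain ⟨n, hn, hle⟩ := ((hρ k).and (hlarge k.natAbs)).exists
    rw [← hn]
    exact hlab n k (by omega) (by omega)

end BiInfinite

end SD

open SD

/-- The left reduction of a Dyck automaton presents the same sofic-Dyck shift;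
more precisely a word labels a finite admissible path of `𝒜` if and only if it
labels a finite admissible path of the left reduction of `𝒜`. -/
theorem statement_8 {A : Type*} [Fintype A] (P : PushdownAlphabet A) {N : ℕ}
    (𝒜 : DyckAutomaton A (Fin N)) (h𝒜 : 𝒜.WellFormed P) :
    presents P (leftReduction P 𝒜) = presents P 𝒜 ∧
      ∀ w : List A,
        (∃ π : List (Fin N × A × Fin N), IsAdmissible P 𝒜 π ∧ pathLabel π = w) ↔
        (∃ π : List (LRState (Fin N) × A × LRState (Fin N)),
            IsAdmissible P (leftReduction P 𝒜) π ∧ pathLabel π = w) := by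
  have hfin := exists_admissible_iff_leftReduction P 𝒜
  refine ⟨?_, hfin⟩
  ext x
  simp only [mem_presents_iff, hfin]
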